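/- arXiv:2408.01740 — 12 statements merged into one kernel-verified Lean document; each statement's English description precedes it below -/
import Mathlib

section
/- Let T > 0, let a, d > 0 and b be real numbers, and let f : [0,T] → ℝ be continuous. Suppose u : [0,1] × [0,T] → ℝ is twice continuously differentiable and satisfies the heat equation u_t(x,t) = u_xx(x,t) for (x,t) ∈ (0,1) × (0,T), the Dirichlet condition u(0,t) = f(t), and the Wentzell condition a·u_xx(1,t) + d·u_x(1,t) − b·u(1,t) = 0 for t ∈ (0,T). Suppose φ : [0,1] × [0,T] → ℝ is twice continuously differentiable and satisfies the backward equation φ_t(x,t) + φ_xx(x,t) = 0, φ(0,t) = 0, and a·φ_xx(1,t) − b·φ(1,t) + d·φ_x(1,t) = 0 for t ∈ (0,T). Then [∫₀¹ u(x,T)φ(x,T) dx + (a/d)·u(1,T)·φ(1,T)] − [∫₀¹ u(x,0)φ(x,0) dx + (a/d)·u(1,0)·φ(1,0)] = ∫₀ᵀ φ_x(0,t)·f(t) dt. -/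
open Real MeasureTheory Set

theorem contDiff_deriv_fst {n : ℕ} {w : ℝ → ℝ → ℝ}
    (hw : ContDiff ℝ (n + 1) (Function.uncurry w)) :
    ContDiff ℝ n (Function.uncurry fun x t => deriv (fun y => w y t) x) := by
  have h : (Function.uncurry fun x t => deriv (fun y => w y t) x)
      = fun p : ℝ × ℝ => fderiv ℝ (Function.uncurry w) p (1, 0) := by
    funext ⟨x, t⟩
    have hd : HasFDerivAt (Function.uncurry w) (fderiv ℝ (Function.uncurry w) (x, t)) (x, t) :=
      (hw.differentiable (by simp) (x, t)).hasFDerivAt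
    exact (hd.comp_hasDerivAt x ((hasDerivAt_id x).prodMk (hasDerivAt_const x t))).deriv
  rw [h]
  exact (hw.fderiv_right le_rfl).clm_apply contDiff_const

theorem contDiff_deriv_snd {n : ℕ} {w : ℝ → ℝ → ℝ}
    (hw : ContDiff ℝ (n + 1) (Function.uncurry w)) :
    ContDiff ℝ n (Function.uncurry fun x t => deriv (fun s => w x s) t) := by
  have h := contDiff_deriv_fst (w := fun t x => w x t) (n := n)
    (hw.comp (contDiff_snd.prodMk contDiff_fst))
  exact h.comp (contDiff_snd.prodMk contDiff_fst)

theorem hasDerivAt_slice_fst {w : ℝ → ℝ → ℝ} (hw : ContDiff ℝ 1 (Function.uncurry w)) (x t : ℝ) :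
    HasDerivAt (fun y => w y t) (deriv (fun y => w y t) x) x :=
  ((hw.comp (contDiff_id.prodMk contDiff_const)).differentiable one_ne_zero x).hasDerivAt

theorem hasDerivAt_slice_snd {w : ℝ → ℝ → ℝ} (hw : ContDiff ℝ 1 (Function.uncurry w)) (x t : ℝ) :
    HasDerivAt (fun s => w x s) (deriv (fun s => w x s) t) t :=
  ((hw.comp (contDiff_const.prodMk contDiff_id)).differentiable one_ne_zero t).hasDerivAt

theorem intervalIntegral_swap_of_continuous {K : ℝ → ℝ → ℝ}
    (hK : Continuous (Function.uncurry K)) (a b c d : ℝ) :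
    ∫ x in a..b, ∫ y in c..d, K x y = ∫ y in c..d, ∫ x in a..b, K x y :=
  intervalIntegral_intervalIntegral_swap <|
    (hK.continuousOn.integrableOn_compact (isCompact_uIcc.prod isCompact_uIcc)).mono_set
      (Set.prod_mono uIoc_subset_uIcc uIoc_subset_uIcc)

/-- **Green's second identity** on an interval. -/
theorem integral_green {v w v' w' v'' w'' : ℝ → ℝ} {a b : ℝ}
    (hv : ∀ x, HasDerivAt v (v' x) x) (hw : ∀ x, HasDerivAt w (w' x) x)
    (hv' : ∀ x, HasDerivAt v' (v'' x) x) (hw' : ∀ x, HasDerivAt w' (w'' x) x)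
    (hv'' : Continuous v'') (hw'' : Continuous w'') :
    ∫ x in a..b, (v'' x * w x - v x * w'' x)
      = (v' b * w b - v b * w' b) - (v' a * w a - v a * w' a) := by
  have cv : Continuous v := continuous_iff_continuousAt.2 fun x => (hv x).continuousAt
  have cw : Continuous w := continuous_iff_continuousAt.2 fun x => (hw x).continuousAt
  refine intervalIntegral.integral_eq_sub_of_hasDerivAt
    (f := fun x => v' x * w x - v x * w' x) (fun x _ => ?_)
    (Continuous.intervalIntegrable (by fun_prop) _ _)
  convert! ((hv' x).mul (hw x)).sub ((hv x).mul (hw' x)) using 1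
  ring

/-- Duality identity between a solution of the heat equation with Wentzell
boundary condition and Dirichlet control, and a solution of the backward
adjoint problem. -/
theorem stmt_0 (T a b d : ℝ) (hT : 0 < T) (ha : 0 < a) (hd : 0 < d)
    (f : ℝ → ℝ) (hf : ContinuousOn f (Set.Icc 0 T))
    (u φ : ℝ → ℝ → ℝ)
    (hu : ContDiff ℝ 2 (Function.uncurry u))
    (hφ : ContDiff ℝ 2 (Function.uncurry φ))
    (heat : ∀ x ∈ Set.Ioo (0:ℝ) 1, ∀ t ∈ Set.Ioo (0:ℝ) T,
      deriv (fun s => u x s) t = deriv (deriv (fun y => u y t)) x)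
    (hDir : ∀ t ∈ Set.Ioo (0:ℝ) T, u 0 t = f t)
    (hWent : ∀ t ∈ Set.Ioo (0:ℝ) T,
      a * deriv (deriv (fun y => u y t)) 1 + d * deriv (fun y => u y t) 1
        - b * u 1 t = 0)
    (hback : ∀ x ∈ Set.Ioo (0:ℝ) 1, ∀ t ∈ Set.Ioo (0:ℝ) T,
      deriv (fun s => φ x s) t + deriv (deriv (fun y => φ y t)) x = 0)
    (hφDir : ∀ t ∈ Set.Ioo (0:ℝ) T, φ 0 t = 0)
    (hφWent : ∀ t ∈ Set.Ioo (0:ℝ) T,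
      a * deriv (deriv (fun y => φ y t)) 1 - b * φ 1 t
        + d * deriv (fun y => φ y t) 1 = 0) :
    ((∫ x in (0:ℝ)..1, u x T * φ x T) + (a / d) * (u 1 T * φ 1 T))
      - ((∫ x in (0:ℝ)..1, u x 0 * φ x 0) + (a / d) * (u 1 0 * φ 1 0))
      = ∫ t in (0:ℝ)..T, deriv (fun y => φ y t) 0 * f t := by
  have hu1 : ContDiff ℝ 1 (Function.uncurry u) := hu.of_le one_le_two
  have hφ1 : ContDiff ℝ 1 (Function.uncurry φ) := hφ.of_le one_le_two
  have hux : ContDiff ℝ 1 (Function.uncurry fun x t => deriv (fun y => u y t) x) :=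
    contDiff_deriv_fst (n := 1) (by norm_num; exact hu)
  have hφx : ContDiff ℝ 1 (Function.uncurry fun x t => deriv (fun y => φ y t) x) :=
    contDiff_deriv_fst (n := 1) (by norm_num; exact hφ)
  have cux : Continuous (Function.uncurry fun x t => deriv (deriv fun y => u y t) x) :=
    (contDiff_deriv_fst (n := 0) (by simpa using hux)).continuous
  have cφx : Continuous (Function.uncurry fun x t => deriv (deriv fun y => φ y t) x) :=
    (contDiff_deriv_fst (n := 0) (by simpa using hφx)).continuous
  have cut : Continuous (Function.uncurry fun x t => deriv (fun s => u x s) t) :=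
    (contDiff_deriv_snd (n := 0) (by simpa using hu1)).continuous
  have cφt : Continuous (Function.uncurry fun x t => deriv (fun s => φ x s) t) :=
    (contDiff_deriv_snd (n := 0) (by simpa using hφ1)).continuous
  have slice {w : ℝ → ℝ → ℝ} (hw : Continuous (Function.uncurry w)) (t : ℝ) :
      Continuous fun x => w x t := hw.comp (continuous_id.prodMk continuous_const)
  have slice' {w : ℝ → ℝ → ℝ} (hw : Continuous (Function.uncurry w)) (x : ℝ) :
      Continuous fun t => w x t := hw.comp (continuous_const.prodMk continuous_id)
  have cIoo : closure (Ioo (0 : ℝ) 1) = Icc 0 1 := closure_Ioo zero_ne_one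
  have heat' : ∀ t ∈ Ioo 0 T, ∀ x ∈ Icc (0 : ℝ) 1,
      deriv (fun s => u x s) t = deriv (deriv fun y => u y t) x := fun t ht x hx =>
    Set.EqOn.closure (fun x hx => heat x hx t ht) (slice cut t) (slice cux t) (cIoo ▸ hx)
  have hback' : ∀ t ∈ Ioo 0 T, ∀ x ∈ Icc (0 : ℝ) 1,
      deriv (fun s => φ x s) t = -deriv (deriv fun y => φ y t) x := fun t ht x hx =>
    Set.EqOn.closure (fun x hx => eq_neg_of_add_eq_zero_left (hback x hx t ht))
      (slice cφt t) (slice cφx t).neg (cIoo ▸ hx)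
  set K : ℝ → ℝ → ℝ :=
    fun x t => deriv (fun s => u x s) t * φ x t + u x t * deriv (fun s => φ x s) t with hKdef
  have hK : Continuous (Function.uncurry K) :=
    (cut.mul hφ.continuous).add (hu.continuous.mul cφt)
  have time (x : ℝ) : ∫ t in (0 : ℝ)..T, K x t = u x T * φ x T - u x 0 * φ x 0 :=
    intervalIntegral.integral_eq_sub_of_hasDerivAt (f := fun t => u x t * φ x t)
      (fun t _ => (hasDerivAt_slice_snd hu1 x t).mul (hasDerivAt_slice_snd hφ1 x t))
      ((slice' hK x).intervalIntegrable _ _)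
  have cprod (t : ℝ) : IntervalIntegrable (fun x => u x t * φ x t) volume 0 1 :=
    ((slice hu.continuous t).mul (slice hφ.continuous t)).intervalIntegrable _ _
  have cinner : Continuous fun t => ∫ x in (0 : ℝ)..1, K x t :=
    intervalIntegral.continuous_parametric_intervalIntegral_of_continuous'
      (f := fun t x => K x t) (hK.comp continuous_swap) 0 1
  calc
    _ = (∫ x in (0 : ℝ)..1, ∫ t in (0 : ℝ)..T, K x t)
        + a / d * ∫ t in (0 : ℝ)..T, K 1 t := by
      simp_rw [time]
      rw [intervalIntegral.integral_sub (cprod T) (cprod 0)]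
      ring
    _ = ∫ t in (0 : ℝ)..T, ((∫ x in (0 : ℝ)..1, K x t) + a / d * K 1 t) := by
      rw [intervalIntegral_swap_of_continuous hK, ← intervalIntegral.integral_const_mul,
        intervalIntegral.integral_add (cinner.intervalIntegrable _ _)
          (((slice' hK 1).const_mul _).intervalIntegrable _ _)]
    _ = _ := by
      refine intervalIntegral.integral_congr_Ioo_of_le hT.le fun t ht => ?_
      have hin : ∫ x in (0 : ℝ)..1, K x t = ∫ x in (0 : ℝ)..1,
          (deriv (deriv fun y => u y t) x * φ x t - u x t * deriv (deriv fun y => φ y t) x) := by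
        refine intervalIntegral.integral_congr fun x hx => ?_
        rw [uIcc_of_le zero_le_one] at hx
        simp only [hKdef, heat' t ht x hx, hback' t ht x hx]
        ring
      have hgreen := integral_green (a := 0) (b := 1) (hasDerivAt_slice_fst hu1 · t)
        (hasDerivAt_slice_fst hφ1 · t) (hasDerivAt_slice_fst hux · t)
        (hasDerivAt_slice_fst hφx · t) (slice cux t) (slice cφx t)
      have h1 : (1 : ℝ) ∈ Icc (0 : ℝ) 1 := right_mem_Icc.2 zero_le_one
      have hbd : a * K 1 t = d * (u 1 t * deriv (fun y => φ y t) 1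
          - deriv (fun y => u y t) 1 * φ 1 t) := by
        simp only [hKdef, heat' t ht 1 h1, hback' t ht 1 h1]
        linear_combination φ 1 t * hWent t ht - u 1 t * hφWent t ht
      have hbd' : a / d * K 1 t = u 1 t * deriv (fun y => φ y t) 1
          - deriv (fun y => u y t) 1 * φ 1 t := by
        rw [div_mul_eq_mul_div, hbd, mul_div_cancel_left₀ _ hd.ne']
      simp only [hin, hbd']
      rw [hgreen, hφDir t ht, hDir t ht]
      ring
end

section
/- Let a, d > 0 and b ∈ ℝ, and let λ ∈ ℂ. If there exists a nonzero twice continuously differentiable function y : [0,1] → ℂ such that y''(x) + λ·y(x) = 0 for all x ∈ [0,1], y(0) = 0, and (a·λ + b)·y(1) = d·y'(1), then λ is real. -/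
open Real

theorem HasDerivAt.complex_re_of_real {f : ℝ → ℂ} {f' : ℂ} {x : ℝ} (h : HasDerivAt f f' x) :
    HasDerivAt (fun t => (f t).re) f'.re x :=
  Complex.reCLM.hasFDerivAt.comp_hasDerivAt x h

theorem HasDerivAt.complex_im_of_real {f : ℝ → ℂ} {f' : ℂ} {x : ℝ} (h : HasDerivAt f f' x) :
    HasDerivAt (fun t => (f t).im) f'.im x :=
  Complex.imCLM.hasFDerivAt.comp_hasDerivAt x h

/-- For a solution `y` of `y'' + lam y = 0`, the function `Im (conj y * y')` has derivative
`-Im lam * |y|²`. -/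
theorem hasDerivAt_im_conj_mul_deriv {y : ℝ → ℂ} (hy : ContDiff ℝ 2 y) {lam : ℂ} {x : ℝ}
    (hx : deriv (deriv y) x + lam * y x = 0) :
    HasDerivAt (fun t => (y t).re * (deriv y t).im - (y t).im * (deriv y t).re)
      (-lam.im * Complex.normSq (y x)) x := by
  have h1 : HasDerivAt y (deriv y x) x := (hy.differentiable (by norm_num) x).hasDerivAt
  have hy' : ContDiff ℝ 1 (deriv y) := ((contDiff_succ_iff_deriv (n := 1)).1 hy).2.2
  have h2 : HasDerivAt (deriv y) (-(lam * y x)) x := by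
    rw [← eq_neg_of_add_eq_zero_left hx]
    exact (hy'.differentiable (by norm_num) x).hasDerivAt
  refine ((h1.complex_re_of_real.mul h2.complex_im_of_real).sub
    (h1.complex_im_of_real.mul h2.complex_re_of_real)).congr_deriv ?_
  simp only [Complex.normSq_apply, Complex.neg_re, Complex.neg_im, Complex.mul_re, Complex.mul_im]
  ring

/-- Eigenvalues of the Sturm–Liouville problem with eigenparameter-dependent
boundary condition are real. -/
theorem stmt_1 (a b d : ℝ) (ha : 0 < a) (hd : 0 < d) (lam : ℂ)
    (y : ℝ → ℂ) (hy : ContDiff ℝ 2 y)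
    (hne : ∃ x ∈ Set.Icc (0:ℝ) 1, y x ≠ 0)
    (hode : ∀ x ∈ Set.Icc (0:ℝ) 1, deriv (deriv y) x + lam * y x = 0)
    (h0 : y 0 = 0)
    (hbc : ((a : ℂ) * lam + (b : ℂ)) * y 1 = (d : ℂ) * deriv y 1) :
    lam.im = 0 := by
  have hc : Continuous fun x => Complex.normSq (y x) :=
    Complex.continuous_normSq.comp hy.continuous
  have hpos : 0 < ∫ x in (0:ℝ)..1, Complex.normSq (y x) := by
    obtain ⟨c, hcm, hcy⟩ := hne
    exact intervalIntegral.integral_pos one_pos hc.continuousOn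
      (fun x _ => Complex.normSq_nonneg _) ⟨c, hcm, Complex.normSq_pos.2 hcy⟩
  have hint := intervalIntegral.integral_eq_sub_of_hasDerivAt
    (fun x hx => hasDerivAt_im_conj_mul_deriv hy
      (hode x (by rwa [Set.uIcc_of_le zero_le_one] at hx)))
    ((continuous_const.mul hc).intervalIntegrable 0 1)
  rw [intervalIntegral.integral_const_mul] at hint
  simp only [h0, Complex.zero_re, Complex.zero_im, zero_mul, sub_zero] at hint
  have hre := congrArg Complex.re hbc
  have him := congrArg Complex.im hbc
  simp only [Complex.mul_re, Complex.mul_im, Complex.add_re, Complex.add_im, Complex.ofReal_re,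
    Complex.ofReal_im, zero_mul, sub_zero, add_zero] at hre him
  have hsum : lam.im * (d * (∫ x in (0:ℝ)..1, Complex.normSq (y x))
      + a * Complex.normSq (y 1)) = 0 := by
    rw [Complex.normSq_apply (y 1)]
    linear_combination -d * hint + (y 1).re * him - (y 1).im * hre
  have hfac : 0 < d * (∫ x in (0:ℝ)..1, Complex.normSq (y x)) + a * Complex.normSq (y 1) :=
    add_pos_of_pos_of_nonneg (mul_pos hd hpos) (mul_nonneg ha.le (Complex.normSq_nonneg _))
  exact (mul_eq_zero.1 hsum).resolve_right hfac.ne'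
end

section
/- Let a, d > 0 and b ∈ ℝ. If μ > 0 and ν > 0 are two distinct solutions of the characteristic equation (a·μ² + b)·sin μ = d·μ·cos μ (respectively with ν in place of μ), then ∫₀¹ sin(μx)·sin(νx) dx + (a/d)·sin μ·sin ν = 0. -/
open Real

/-- Lagrange's identity for `sin (μ x)` and `sin (ν x)` on the unit interval. -/
theorem sq_sub_sq_mul_integral_sin_mul_sin (μ ν : ℝ) :
    (μ ^ 2 - ν ^ 2) * (∫ x in (0:ℝ)..1, Real.sin (μ * x) * Real.sin (ν * x))
      = ν * Real.sin μ * Real.cos ν - μ * Real.cos μ * Real.sin ν := by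
  have hderiv (x : ℝ) :
      HasDerivAt (fun x => ν * Real.sin (μ * x) * Real.cos (ν * x)
          - μ * Real.cos (μ * x) * Real.sin (ν * x))
        ((μ ^ 2 - ν ^ 2) * (Real.sin (μ * x) * Real.sin (ν * x))) x := by
    have hμ : HasDerivAt (fun x => μ * x) μ x := by
      simpa using (hasDerivAt_id x).const_mul μ
    have hν : HasDerivAt (fun x => ν * x) ν x := by
      simpa using (hasDerivAt_id x).const_mul ν
    refine (((hμ.sin.const_mul ν).mul hν.cos).sub
      ((hμ.cos.const_mul μ).mul hν.sin)).congr_deriv ?_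
    ring
  rw [← intervalIntegral.integral_const_mul,
    intervalIntegral.integral_eq_sub_of_hasDerivAt (fun x _ => hderiv x)
      (Continuous.intervalIntegrable (by fun_prop) _ _)]
  simp

/-- Orthogonality in H = L²(0,1) ⊕ ℝ of eigenfunctions sin(μx), sin(νx)
corresponding to distinct positive roots of the characteristic equation. -/
theorem stmt_2 (a b d : ℝ) (ha : 0 < a) (hd : 0 < d)
    (μ ν : ℝ) (hμ : 0 < μ) (hν : 0 < ν) (hne : μ ≠ ν)
    (hμeq : (a * μ ^ 2 + b) * Real.sin μ = d * μ * Real.cos μ)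
    (hνeq : (a * ν ^ 2 + b) * Real.sin ν = d * ν * Real.cos ν) :
    (∫ x in (0:ℝ)..1, Real.sin (μ * x) * Real.sin (ν * x))
      + (a / d) * (Real.sin μ * Real.sin ν) = 0 := by
  have hint := sq_sub_sq_mul_integral_sin_mul_sin μ ν
  have hsq : μ ^ 2 - ν ^ 2 ≠ 0 := by
    rw [sq_sub_sq]
    exact mul_ne_zero (by positivity) (sub_ne_zero.mpr hne)
  apply mul_left_cancel₀ (mul_ne_zero hd.ne' hsq)
  have had : d * (a / d) = a := mul_div_cancel₀ a hd.ne'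
  linear_combination (μ ^ 2 - ν ^ 2) * Real.sin μ * Real.sin ν * had + d * hint
    + Real.sin ν * hμeq - Real.sin μ * hνeq
end

section
/- Let a, d > 0 and 0 ≤ b < d. Then for every integer n ≥ 0 there exists μ with π·n < μ < π·n + π/2 and μ > 0 satisfying the characteristic equation (a·μ² + b)·sin μ = d·μ·cos μ. -/
open Real

/-- For `n = 0` the characteristic function is negative somewhere in `(0, 1)`. -/
lemma exists_charFun_neg_of_lt {a b d : ℝ} (ha : 0 < a) (hd : 0 < d) (hb : 0 ≤ b) (hbd : b < d) :
    ∃ t : ℝ, 0 < t ∧ t < 1 ∧ (a * t ^ 2 + b) * sin t - d * t * cos t < 0 := by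
  have had : 0 < a + d := by positivity
  obtain ⟨t, ht⟩ : ∃ t : ℝ, t * (a + d) = d - b := ⟨(d - b) / (a + d), by field_simp⟩
  have ht0 : 0 < t := by
    by_contra! h
    nlinarith
  have ht1 : t < 1 := by
    by_contra! h
    nlinarith
  refine ⟨t, ht0, ht1, ?_⟩
  have hs : (a * t ^ 2 + b) * sin t ≤ (a * t ^ 2 + b) * t :=
    mul_le_mul_of_nonneg_left (sin_lt ht0).le (by positivity)
  have hc : d * t * (1 - t ^ 2 / 2) ≤ d * t * cos t :=
    mul_le_mul_of_nonneg_left one_sub_sq_div_two_le_cos (by positivity)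
  have hsq : t ^ 2 * (a + d) < d - b := by
    have : t * (t * (a + d)) < 1 * (t * (a + d)) :=
      mul_lt_mul_of_pos_right ht1 (by positivity)
    linarith
  have hpos : 0 < d * t ^ 2 := by positivity
  have hprod : t * (a * t ^ 2 + b - d + d * t ^ 2 / 2) < 0 :=
    mul_neg_of_pos_of_neg ht0 (by linarith)
  linarith

/-- Existence of a root of the characteristic equation in each interval
(πn, πn + π/2), in the regime 0 ≤ b < d. -/
theorem stmt_3 (a b d : ℝ) (ha : 0 < a) (hd : 0 < d)
    (hb0 : 0 ≤ b) (hbd : b < d) :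
    ∀ n : ℕ, ∃ μ : ℝ, π * n < μ ∧ μ < π * n + π / 2 ∧ 0 < μ ∧
      (a * μ ^ 2 + b) * Real.sin μ = d * μ * Real.cos μ := by
  intro n
  let g : ℝ → ℝ := fun t =>
    (a * (t + n * π) ^ 2 + b) * sin t - d * (t + n * π) * cos t
  have hnπ : 0 ≤ (n : ℝ) * π := by positivity
  obtain ⟨s, hs0, hs1, hs⟩ : ∃ s : ℝ, 0 ≤ s ∧ s < π / 2 ∧ g s < 0 := by
    rcases Nat.eq_zero_or_pos n with rfl | hn
    · obtain ⟨t, ht0, ht1, ht⟩ := exists_charFun_neg_of_lt ha hd hb0 hbd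
      exact ⟨t, ht0.le, by linarith [pi_gt_three], by simpa [g] using ht⟩
    · refine ⟨0, le_rfl, by positivity, ?_⟩
      have : 0 < d * (n * π) := by positivity
      simpa [g] using this
  have hend : 0 < g (π / 2) := by
    have : 0 < a * (π / 2 + n * π) ^ 2 + b := by positivity
    simpa [g] using this
  have hg : Continuous g := by fun_prop
  obtain ⟨t, ⟨hst, htπ⟩, ht⟩ := intermediate_value_Ioo hs1.le hg.continuousOn ⟨hs, hend⟩
  refine ⟨t + n * π, by linarith, by linarith, by linarith, ?_⟩
  rw [sin_add_nat_mul_pi, cos_add_nat_mul_pi]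
  linear_combination (-1 : ℝ) ^ n * ht
end

section
/- Let a, d > 0 and 0 ≤ b < d, and let n ≥ 1 be an integer with a·(π·n)² > b. Then there is exactly one μ in the open interval (π·n, π·n + π/2) satisfying the characteristic equation (a·μ² + b)·sin μ = d·μ·cos μ. -/
open Real

/-- Shifting by an integer multiple of `π` does not affect a linear relation between
`sin` and `cos`. -/
theorem mul_sin_eq_mul_cos_add_nat_mul_pi_iff (p q t : ℝ) (n : ℕ) :
    p * sin (t + n * π) = q * cos (t + n * π) ↔ p * sin t = q * cos t := by
  rw [sin_add_nat_mul_pi, cos_add_nat_mul_pi, mul_left_comm p, mul_left_comm q]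
  exact mul_right_inj' (pow_ne_zero n (by norm_num))

/-- The function `x ↦ x / (a * x ^ 2 + b)` is strictly decreasing where `b < a * x ^ 2`,
in cross-multiplied form. -/
theorem mul_quadratic_lt_mul_quadratic {a b x y : ℝ} (ha : 0 < a) (hx : 0 < x)
    (hxy : x < y) (hb : b < a * x ^ 2) :
    y * (a * x ^ 2 + b) < x * (a * y ^ 2 + b) := by
  have h : b < a * x * y := by nlinarith [mul_pos (mul_pos ha hx) (sub_pos.2 hxy)]
  nlinarith [mul_pos (sub_pos.2 hxy) (sub_pos.2 h)]

/-- Two distinct points of `(0, π / 2)` cannot both solve the shifted characteristic equation. -/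
theorem not_lt_of_characteristic_eq {a b d c s t : ℝ} (ha : 0 < a) (hd : 0 < d) (hb : 0 ≤ b)
    (hc : 0 < c) (hbc : b < a * c ^ 2) (hs : 0 < s) (ht : t < π / 2)
    (hse : (a * (s + c) ^ 2 + b) * sin s = d * (s + c) * cos s)
    (hte : (a * (t + c) ^ 2 + b) * sin t = d * (t + c) * cos t) : ¬ s < t := by
  intro hst
  have hsin : 0 < sin s := sin_pos_of_pos_of_lt_pi hs (by linarith [pi_pos])
  have hcos : 0 < cos t := cos_pos_of_mem_Ioo ⟨by linarith [pi_pos], ht⟩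
  have hsub : sin s * cos t < cos s * sin t := by
    have h : 0 < sin (t - s) := sin_pos_of_pos_of_lt_pi (by linarith) (by linarith [pi_pos])
    rw [sin_sub] at h
    linarith
  have hbs : b < a * (s + c) ^ 2 := hbc.trans (by gcongr; linarith)
  have hquad := mul_quadratic_lt_mul_quadratic (y := t + c) ha (by linarith : 0 < s + c)
    (by linarith) hbs
  have hlt : (t + c) * (a * (s + c) ^ 2 + b) * (sin s * cos t) <
      (s + c) * (a * (t + c) ^ 2 + b) * (cos s * sin t) := by
    have hpos : 0 < (s + c) * (a * (t + c) ^ 2 + b) := by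
      have : 0 < s + c := by linarith
      have : 0 < t + c := by linarith
      positivity
    exact mul_lt_mul'' hquad hsub
      (mul_nonneg (by linarith) (by positivity)) (mul_pos hsin hcos).le
  have heq : d * ((t + c) * (a * (s + c) ^ 2 + b) * (sin s * cos t)) =
      d * ((s + c) * (a * (t + c) ^ 2 + b) * (cos s * sin t)) := by
    linear_combination d * (t + c) * cos t * hse - d * (s + c) * cos s * hte
  exact hlt.ne (mul_left_cancel₀ hd.ne' heq)

/-- The shifted characteristic equation has a solution in `(0, π / 2)`. -/
theorem exists_characteristic_eq {a b d c : ℝ} (ha : 0 < a) (hd : 0 < d) (hb : 0 ≤ b)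
    (hc : 0 < c) : ∃ t ∈ Set.Ioo 0 (π / 2),
      (a * (t + c) ^ 2 + b) * sin t = d * (t + c) * cos t := by
  have hcont : ContinuousOn
      (fun t ↦ (a * (t + c) ^ 2 + b) * sin t - d * (t + c) * cos t)
      (Set.Icc 0 (π / 2)) := by fun_prop
  obtain ⟨t, ht, h⟩ := intermediate_value_Ioo pi_div_two_pos.le hcont
    (show (0 : ℝ) ∈ Set.Ioo _ _ by
      simp only [sin_zero, cos_zero, sin_pi_div_two, cos_pi_div_two, mul_zero, mul_one,
        zero_add, zero_sub, sub_zero]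
      have := pi_pos
      exact ⟨neg_neg_of_pos (by positivity), by positivity⟩)
  exact ⟨t, ht, sub_eq_zero.1 h⟩

/-- Uniqueness of the root of the characteristic equation in
(πn, πn + π/2) when a(πn)² > b, in the regime 0 ≤ b < d. -/
theorem stmt_4 (a b d : ℝ) (ha : 0 < a) (hd : 0 < d)
    (hb0 : 0 ≤ b) (hbd : b < d) (n : ℕ) (hn : 1 ≤ n)
    (hab : a * (π * n) ^ 2 > b) :
    ∃! μ : ℝ, μ ∈ Set.Ioo (π * n) (π * n + π / 2) ∧
      (a * μ ^ 2 + b) * Real.sin μ = d * μ * Real.cos μ := by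
  rw [mul_comm π (n : ℝ)] at hab ⊢
  have hc : 0 < (n : ℝ) * π := mul_pos (by exact_mod_cast hn) pi_pos
  obtain ⟨t, ⟨ht0, ht1⟩, hte⟩ := exists_characteristic_eq (c := n * π) ha hd hb0 hc
  refine ⟨t + n * π, ⟨⟨by linarith, by linarith⟩,
    (mul_sin_eq_mul_cos_add_nat_mul_pi_iff _ _ t n).2 hte⟩, ?_⟩
  rintro μ ⟨⟨hμ0, hμ1⟩, hμ⟩
  obtain ⟨s, rfl⟩ : ∃ s, μ = s + n * π := ⟨μ - n * π, by ring⟩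
  have hse := (mul_sin_eq_mul_cos_add_nat_mul_pi_iff _ _ s n).1 hμ
  have hs0 : 0 < s := by linarith
  have hs1 : s < π / 2 := by linarith
  rw [le_antisymm
    (not_lt.1 (not_lt_of_characteristic_eq ha hd hb0 hc hab ht0 hs1 hte hse))
    (not_lt.1 (not_lt_of_characteristic_eq ha hd hb0 hc hab hs0 ht1 hse hte))]
end

section
/- Let a, d > 0 and 0 ≤ b < d, and for each integer n ≥ 1 let μ_n ∈ (π·n, π·n + π/2) be a solution of the characteristic equation (a·μ² + b)·sin μ = d·μ·cos μ. Then there exists a constant C > 0 such that |μ_n − π·n − d/(a·π·n)| ≤ C/n³ for all n ≥ 1. -/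
open Real

/-- A solution `x ∈ (0, π/2)` of the characteristic equation at `μ = N + x` differs from `d / (a N)`
by `O(N⁻³)`, with an explicit constant. -/
theorem abs_sub_div_le_of_char_eq {a b d N x : ℝ} (ha : 0 < a) (hd : 0 < d) (hb : 0 ≤ b)
    (hN : 0 < N) (hx0 : 0 < x) (hx : x < π / 2)
    (h : (a * (N + x) ^ 2 + b) * sin x = d * (N + x) * cos x) :
    |x - d / (a * N)| ≤ (d * (d + b) / a ^ 2 + d ^ 3 / (2 * a ^ 3)) / N ^ 3 := by
  have hcos : 0 < cos x := cos_pos_of_mem_Ioo ⟨by linarith, hx⟩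
  have hm : 0 < N + x := by positivity
  obtain ⟨m, rfl⟩ : ∃ m, x = m - N := ⟨N + x, by ring⟩
  rw [add_sub_cancel] at h hm
  have hq : 0 < a * m ^ 2 + b := by positivity
  have hNm : N ≤ m := by linarith
  obtain ⟨t, ht⟩ : ∃ t, t = d * m / (a * m ^ 2 + b) := ⟨_, rfl⟩
  have htan : tan (m - N) = t := by
    rw [ht, tan_eq_sin_div_cos, div_eq_div_iff hcos.ne' hq.ne']
    linarith
  have hxt : m - N < t := htan ▸ lt_tan hx0 hx
  have ht0 : 0 < t := hx0.trans hxt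
  have htm : m * t ≤ d / a := by
    rw [ht, le_div_iff₀ ha, mul_div_assoc', div_mul_eq_mul_div, div_le_iff₀ hq]
    nlinarith [mul_nonneg hd.le hb]
  have hdiff : d / (a * N) - t = d * (a * (m * (m - N)) + b) / (a * N * (a * m ^ 2 + b)) := by
    rw [ht]
    field_simp
    ring
  have hst : t ≤ d / (a * N) := by
    have : 0 ≤ d / (a * N) - t := by rw [hdiff]; positivity
    linarith
  have hupper : d / (a * N) - t ≤ d * (d + b) / a ^ 2 / N ^ 3 := by
    have hmx : a * (m * (m - N)) ≤ d := by
      have : m * (m - N) ≤ d / a := (mul_le_mul_of_nonneg_left hxt.le hm.le).trans htm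
      rwa [le_div_iff₀' ha] at this
    have hden : a ^ 2 * N ^ 3 ≤ a * N * (a * m ^ 2 + b) := by
      calc a ^ 2 * N ^ 3 = a * N * (a * N ^ 2 + 0) := by ring
        _ ≤ a * N * (a * m ^ 2 + b) := by gcongr
    rw [hdiff, div_div]
    gcongr
  have hlower : t - t ^ 3 / 2 ≤ m - N := by
    have hsin : sin (m - N) = t * cos (m - N) := by
      rw [← htan, tan_mul_cos hcos.ne']
    have h1 : sin (m - N) ≤ m - N := sin_le hx0.le
    have h2 : 1 - t ^ 2 / 2 ≤ cos (m - N) := by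
      have := one_sub_sq_div_two_le_cos (x := m - N)
      have : (m - N) ^ 2 ≤ t ^ 2 := by gcongr
      linarith
    have h3 := mul_le_mul_of_nonneg_left h2 ht0.le
    linarith
  have hcube : t ^ 3 / 2 ≤ d ^ 3 / (2 * a ^ 3) / N ^ 3 := by
    calc t ^ 3 / 2 ≤ (d / (a * N)) ^ 3 / 2 := by gcongr
      _ = d ^ 3 / (2 * a ^ 3) / N ^ 3 := by field_simp
  have hpos : 0 ≤ d * (d + b) / a ^ 2 / N ^ 3 := by positivity
  have hpos' : 0 ≤ d ^ 3 / (2 * a ^ 3) / N ^ 3 := by positivity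
  rw [add_div, abs_le]
  constructor <;> linarith

/-- Asymptotic expansion μ_n = πn + d/(aπn) + O(1/n³) of the square roots of
the eigenvalues. -/
theorem stmt_5 (a b d : ℝ) (ha : 0 < a) (hd : 0 < d)
    (hb0 : 0 ≤ b) (hbd : b < d) (μ : ℕ → ℝ)
    (hμ : ∀ n : ℕ, 1 ≤ n → μ n ∈ Set.Ioo (π * n) (π * n + π / 2) ∧
      (a * (μ n) ^ 2 + b) * Real.sin (μ n) = d * (μ n) * Real.cos (μ n)) :
    ∃ C : ℝ, 0 < C ∧ ∀ n : ℕ, 1 ≤ n →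
      |μ n - π * n - d / (a * π * n)| ≤ C / (n : ℝ) ^ 3 := by
  refine ⟨d * (d + b) / a ^ 2 + d ^ 3 / (2 * a ^ 3), by positivity, fun n hn => ?_⟩
  obtain ⟨⟨h1, h2⟩, h⟩ := hμ n hn
  have hn0 : (0 : ℝ) < n := by exact_mod_cast hn
  have hx : (a * (π * n + (μ n - π * n)) ^ 2 + b) * sin (μ n - π * n) =
      d * (π * n + (μ n - π * n)) * cos (μ n - π * n) := by
    rw [add_sub_cancel, mul_comm π, sin_sub_nat_mul_pi, cos_sub_nat_mul_pi]
    linear_combination (-1) ^ n * h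
  have key := abs_sub_div_le_of_char_eq ha hd hb0 (mul_pos pi_pos hn0) (sub_pos.2 h1)
    (by linarith) hx
  rw [← mul_assoc] at key
  refine key.trans ?_
  gcongr
  nlinarith [pi_gt_three]
end

section
/- Let a, d > 0 and 0 ≤ b < d, and for each integer n ≥ 1 let μ_n ∈ (π·n, π·n + π/2) be a solution of the characteristic equation (a·μ² + b)·sin μ = d·μ·cos μ. Then there exists a constant C > 0 such that for all n ≥ 1 and all x ∈ [0,1], |sin(μ_n·x) − sin(π·n·x) − (d/(a·π·n))·x·cos(π·n·x)| ≤ C/n². -/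
open Real

lemma mul_cos_le_sin {t : ℝ} (h0 : 0 ≤ t) (h1 : t < π / 2) : t * cos t ≤ sin t := by
  have hc : 0 < cos t := cos_pos_of_mem_Ioo ⟨by linarith [pi_pos], h1⟩
  have h := le_tan h0 h1
  rwa [tan_eq_sin_div_cos, le_div_iff₀ hc] at h

lemma abs_sin_sub_self_le_sq {t : ℝ} (h0 : 0 ≤ t) (h1 : t < π / 2) : |sin t - t| ≤ t ^ 2 := by
  have h := mul_cos_le_sin h0 h1
  have hc := one_sub_sq_div_two_le_cos (x := t)
  have h2 : t ≤ 2 := by linarith [pi_le_four]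
  rw [abs_le]
  constructor
  · nlinarith [mul_le_mul_of_nonneg_left hc h0, mul_nonneg (sq_nonneg t) (sub_nonneg.2 h2)]
  · nlinarith [sin_le h0, sq_nonneg t]

/-- First-order expansion of `sin` at `y`, with an approximate increment `K` in place of `e`. -/
lemma abs_sin_add_sub_sub_le {y e K x : ℝ} (he0 : 0 ≤ e) (he1 : e < π / 2)
    (hx0 : 0 ≤ x) (hx1 : x ≤ 1) :
    |sin (y + e * x) - sin y - K * x * cos y| ≤ 3 / 2 * e ^ 2 + |K - e| := by
  have ht0 : 0 ≤ e * x := mul_nonneg he0 hx0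
  have hte : e * x ≤ e := mul_le_of_le_one_right he0 hx1
  have hsq : (e * x) ^ 2 ≤ e ^ 2 := pow_le_pow_left₀ ht0 hte 2
  have h1 : |sin y * (cos (e * x) - 1)| ≤ e ^ 2 / 2 := by
    rw [abs_mul]
    refine (mul_le_of_le_one_left (abs_nonneg _) (abs_sin_le_one y)).trans ?_
    rw [abs_le]
    constructor <;>
      linarith [one_sub_sq_div_two_le_cos (x := e * x), cos_le_one (e * x), sq_nonneg e]
  have h2 : |cos y * (sin (e * x) - e * x)| ≤ e ^ 2 := by
    rw [abs_mul]
    exact (mul_le_of_le_one_left (abs_nonneg _) (abs_cos_le_one y)).trans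
      ((abs_sin_sub_self_le_sq ht0 (hte.trans_lt he1)).trans hsq)
  have h3 : |(K - e) * (x * cos y)| ≤ |K - e| := by
    rw [abs_mul]
    refine mul_le_of_le_one_right (abs_nonneg _) ?_
    rw [abs_mul, abs_of_nonneg hx0]
    exact mul_le_one₀ hx1 (abs_nonneg _) (abs_cos_le_one y)
  have key : sin (y + e * x) - sin y - K * x * cos y = sin y * (cos (e * x) - 1)
      + cos y * (sin (e * x) - e * x) - (K - e) * (x * cos y) := by
    rw [sin_add]; ring
  rw [key]
  refine (abs_sub _ _).trans ?_
  linarith [abs_add_le (sin y * (cos (e * x) - 1)) (cos y * (sin (e * x) - e * x))]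

lemma characteristic_eq_shift {a b d e : ℝ} (n : ℕ)
    (h : (a * (π * n + e) ^ 2 + b) * sin (π * n + e) = d * (π * n + e) * cos (π * n + e)) :
    (a * (π * n + e) ^ 2 + b) * sin e = d * (π * n + e) * cos e := by
  have hs : sin (π * n + e) = (-1) ^ n * sin e := by
    rw [add_comm, mul_comm π, sin_add_nat_mul_pi]
  have hc : cos (π * n + e) = (-1) ^ n * cos e := by
    rw [add_comm, mul_comm π, cos_add_nat_mul_pi]
  rw [hs, hc] at h
  have h0 : ((-1 : ℝ)) ^ n ≠ 0 := pow_ne_zero _ (by norm_num)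
  apply mul_left_cancel₀ h0
  linear_combination h

lemma shift_le {a b d N e : ℝ} (ha : 0 < a) (hb : 0 ≤ b) (hN : 0 < N)
    (he0 : 0 ≤ e) (he1 : e < π / 2)
    (h : (a * (N + e) ^ 2 + b) * sin e = d * (N + e) * cos e) : e ≤ d / (a * N) := by
  have hc : 0 < cos e := cos_pos_of_mem_Ioo ⟨by linarith [pi_pos], he1⟩
  have hD : 0 < a * (N + e) ^ 2 + b := by positivity
  have h1 : (a * (N + e) ^ 2 + b) * e ≤ d * (N + e) := by
    refine le_of_mul_le_mul_right ?_ hc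
    rw [← h, mul_assoc]
    exact mul_le_mul_of_nonneg_left (mul_cos_le_sin he0 he1) hD.le
  have h2 : a * (N + e) * e ≤ d := by
    refine le_of_mul_le_mul_right ?_ (show 0 < N + e by positivity)
    nlinarith [mul_nonneg hb he0]
  rw [le_div_iff₀ (by positivity)]
  nlinarith [mul_nonneg ha.le (sq_nonneg e)]

lemma sub_shift_le {a b d N e : ℝ} (ha : 0 < a) (hb : 0 ≤ b) (hd : 0 ≤ d) (hN : 0 < N)
    (he0 : 0 ≤ e) (h : (a * (N + e) ^ 2 + b) * sin e = d * (N + e) * cos e) :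
    d / (a * N) - e ≤ d / (a * N) * (e / N + b / (a * N ^ 2) + e ^ 2 / 2) := by
  set K := d / (a * N) with hK
  have hK0 : 0 ≤ K := by positivity
  have hdK : d = a * N * K := by rw [hK]; field_simp
  have hD : 0 < a * (N + e) ^ 2 + b := by positivity
  have h1 : d * (N + e) * (1 - e ^ 2 / 2) ≤ (a * (N + e) ^ 2 + b) * e :=
    (mul_le_mul_of_nonneg_left one_sub_sq_div_two_le_cos (by positivity)).trans
      (h ▸ mul_le_mul_of_nonneg_left (sin_le he0) hD.le)
  have hsq : a * (N + e) * N ≤ a * (N + e) ^ 2 + b := by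
    nlinarith [mul_nonneg (mul_nonneg ha.le (add_nonneg hN.le he0)) he0]
  have h2 : a * (N + e) * e ≤ (a * (N + e) ^ 2 + b) * (e / N) := by
    rw [← mul_div_assoc, le_div_iff₀ hN]
    nlinarith [mul_le_mul_of_nonneg_right hsq he0]
  have h3 : b ≤ (a * (N + e) ^ 2 + b) * (b / (a * N ^ 2)) := by
    rw [← mul_div_assoc, le_div_iff₀ (by positivity), mul_comm]
    refine mul_le_mul_of_nonneg_right ?_ hb
    nlinarith [mul_nonneg (mul_nonneg ha.le hN.le) he0]
  have h4 := mul_le_mul_of_nonneg_right hsq (by positivity : 0 ≤ e ^ 2 / 2)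
  refine le_of_mul_le_mul_left ?_ hD
  have h5 := mul_le_mul_of_nonneg_left (add_le_add (add_le_add h2 h3) h4) hK0
  rw [hdK] at h1
  linarith

/-- Uniform asymptotic expansion of the eigenfunctions
y_n(x) = sin(μ_n x) = sin(πnx) + (d/(aπn)) x cos(πnx) + O(1/n²). -/
theorem stmt_6 (a b d : ℝ) (ha : 0 < a) (hd : 0 < d)
    (hb0 : 0 ≤ b) (hbd : b < d) (μ : ℕ → ℝ)
    (hμ : ∀ n : ℕ, 1 ≤ n → μ n ∈ Set.Ioo (π * n) (π * n + π / 2) ∧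
      (a * (μ n) ^ 2 + b) * Real.sin (μ n) = d * (μ n) * Real.cos (μ n)) :
    ∃ C : ℝ, 0 < C ∧ ∀ n : ℕ, 1 ≤ n → ∀ x ∈ Set.Icc (0:ℝ) 1,
      |Real.sin (μ n * x) - Real.sin (π * n * x)
        - (d / (a * π * n)) * x * Real.cos (π * n * x)| ≤ C / (n : ℝ) ^ 2 := by
  obtain ⟨k, hk⟩ : ∃ k, k = d / (a * π) := ⟨_, rfl⟩
  have hk0 : 0 < k := by rw [hk]; positivity
  refine ⟨3 / 2 * k ^ 2 + k * (k + b / a + k ^ 2 / 2), by positivity, ?_⟩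
  rintro n hn x ⟨hx0, hx1⟩
  obtain ⟨⟨hl, hu⟩, heq⟩ := hμ n hn
  obtain ⟨e, he⟩ : ∃ e, μ n = π * n + e := ⟨μ n - π * n, by ring⟩
  rw [he] at hl hu heq ⊢
  have he0 : 0 ≤ e := by linarith
  have he1 : e < π / 2 := by linarith
  have hm : (1 : ℝ) ≤ n := by exact_mod_cast hn
  have hm0 : (0 : ℝ) < n := by linarith
  have hN : 0 < π * n := by positivity
  have hmN : (n : ℝ) ≤ π * n := le_mul_of_one_le_left hm0.le (by linarith [pi_gt_three])
  have hK : d / (a * (π * n)) = k / n := by rw [hk]; field_simp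
  have heq' := characteristic_eq_shift n heq
  have h1 := shift_le ha hb0 hN he0 he1 heq'
  have h2 := sub_shift_le ha hb0 hd.le hN he0 heq'
  rw [hK] at h1 h2
  have hek : e ≤ k := h1.trans (div_le_self hk0.le hm)
  have hbr : e / (π * n) + b / (a * (π * n) ^ 2) + e ^ 2 / 2 ≤ (k + b / a + k ^ 2 / 2) / n := by
    have t1 : e / (π * n) ≤ k / n := by gcongr
    have t2 : b / (a * (π * n) ^ 2) ≤ b / a / n := by
      rw [div_div]
      gcongr
      nlinarith
    have t3 : e ^ 2 / 2 ≤ k ^ 2 / 2 / n := by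
      have : e ^ 2 ≤ k * (k / n) := by
        rw [pow_two]; exact mul_le_mul hek h1 he0 hk0.le
      calc e ^ 2 / 2 ≤ k * (k / n) / 2 := by gcongr
        _ = k ^ 2 / 2 / n := by ring
    rw [add_div, add_div]
    linarith
  have h4 : |k / n - e| ≤ k / n * ((k + b / a + k ^ 2 / 2) / n) := by
    rw [abs_of_nonneg (sub_nonneg.2 h1)]
    exact h2.trans (mul_le_mul_of_nonneg_left hbr (by positivity))
  have h6 := abs_sin_add_sub_sub_le (y := π * n * x) (K := k / n) he0 he1 hx0 hx1
  rw [add_mul, mul_assoc a, hK]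
  calc _ ≤ 3 / 2 * e ^ 2 + |k / n - e| := h6
    _ ≤ 3 / 2 * (k / n) ^ 2 + k / n * ((k + b / a + k ^ 2 / 2) / n) := by gcongr
    _ = _ := by field_simp
end

section
/- Let T > 0, let a, d > 0 and 0 ≤ b < d, and for each integer n ≥ 0 let μ_n ∈ (π·n, π·n + π/2), μ_n > 0, be a solution of the characteristic equation (a·μ² + b)·sin μ = d·μ·cos μ, and set λ_n = μ_n². Then there exists a family of functions (Θ_n)_{n≥0} in L²(0,T) biorthogonal to the exponential family {e^{−λ_m·t}}_{m≥0}, i.e. ∫₀ᵀ e^{−λ_m·t}·Θ_n(t) dt = 1 if m = n and = 0 if m ≠ n, for all integers m, n ≥ 0. -/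
open Real MeasureTheory

/-- A difference operator `f ↦ f (· + ε) - q f` is bounded from `L²(0, τ + ε)` to `L²(0, τ)` by
`1 + q`. -/
lemma eLpNorm_comp_add_sub_mul_le {f : ℝ → ℝ} (hf : Continuous f) {ε q : ℝ} (hε : 0 ≤ ε)
    (hq : 0 ≤ q) (τ : ℝ) :
    eLpNorm (fun t => f (t + ε) - q * f t) 2 (volume.restrict (Set.Ioc 0 τ)) ≤
      ENNReal.ofReal (1 + q) * eLpNorm f 2 (volume.restrict (Set.Ioc 0 (τ + ε))) := by
  have hshift : eLpNorm (fun t => f (t + ε)) 2 (volume.restrict (Set.Ioc 0 τ)) ≤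
      eLpNorm f 2 (volume.restrict (Set.Ioc 0 (τ + ε))) := by
    have hmp := (measurePreserving_add_right (volume : Measure ℝ) ε).restrict_preimage
      (measurableSet_Ioc (a := ε) (b := τ + ε))
    have hpre : (fun t : ℝ => t + ε) ⁻¹' Set.Ioc ε (τ + ε) = Set.Ioc 0 τ := by
      ext t; simp
    rw [hpre] at hmp
    have := eLpNorm_comp_measurePreserving (p := 2) hf.aestronglyMeasurable hmp
    rw [Function.comp_def] at this
    rw [this]
    exact eLpNorm_mono_measure _
      (Measure.restrict_mono (Set.Ioc_subset_Ioc_left hε) le_rfl)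
  have hself : eLpNorm (fun t => q * f t) 2 (volume.restrict (Set.Ioc 0 τ)) ≤
      ENNReal.ofReal q * eLpNorm f 2 (volume.restrict (Set.Ioc 0 (τ + ε))) := by
    have := eLpNorm_const_smul q f 2 (volume.restrict (Set.Ioc 0 τ))
    rw [Real.enorm_eq_ofReal hq] at this
    change eLpNorm (q • f) 2 _ ≤ _
    rw [this]
    exact mul_le_mul_right (eLpNorm_mono_measure f
      (Measure.restrict_mono (Set.Ioc_subset_Ioc_right (le_add_of_nonneg_right hε)) le_rfl)) _
  have hsub := eLpNorm_sub_le (p := 2) (μ := volume.restrict (Set.Ioc 0 τ))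
    (f := fun t => f (t + ε)) (g := fun t => q * f t)
    (by fun_prop) (by fun_prop) (by norm_num)
  refine hsub.trans ?_
  rw [ENNReal.ofReal_add zero_le_one hq, add_mul, ENNReal.ofReal_one, one_mul]
  exact add_le_add hshift hself

/-- Iterating the difference operators `f ↦ f (· + ε m) - exp (-l m * ε m) f` on an exponential
sum. -/
lemma eLpNorm_sum_prod_mul_exp_le {l ε : ℕ → ℝ} (hε : ∀ m, 0 ≤ ε m) (S R : Finset ℕ) (c : ℕ → ℝ)
    (τ : ℝ) :
    eLpNorm (fun t => ∑ j ∈ S,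
        c j * (∏ m ∈ R, (exp (-l j * ε m) - exp (-l m * ε m))) * exp (-l j * t)) 2
        (volume.restrict (Set.Ioc 0 τ)) ≤
      ENNReal.ofReal (∏ m ∈ R, (1 + exp (-l m * ε m))) *
        eLpNorm (fun t => ∑ j ∈ S, c j * exp (-l j * t)) 2
          (volume.restrict (Set.Ioc 0 (τ + ∑ m ∈ R, ε m))) := by
  induction R using Finset.induction_on generalizing c with
  | empty => simp
  | insert k R hk ih =>
    have h1 := ih (fun j => c j * (exp (-l j * ε k) - exp (-l k * ε k)))
    have h2 := eLpNorm_comp_add_sub_mul_le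
      (f := fun t => ∑ j ∈ S, c j * exp (-l j * t)) (by fun_prop) (hε k)
      (exp_pos (-l k * ε k)).le (τ + ∑ m ∈ R, ε m)
    have e1 : (fun t => ∑ j ∈ S, c j * (∏ m ∈ insert k R, (exp (-l j * ε m) - exp (-l m * ε m))) *
        exp (-l j * t)) = fun t => ∑ j ∈ S, c j * (exp (-l j * ε k) - exp (-l k * ε k)) *
        (∏ m ∈ R, (exp (-l j * ε m) - exp (-l m * ε m))) * exp (-l j * t) := by
      funext t
      refine Finset.sum_congr rfl fun j _ => ?_
      rw [Finset.prod_insert hk]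
      ring
    have e2 : (fun t => ∑ j ∈ S, c j * (exp (-l j * ε k) - exp (-l k * ε k)) * exp (-l j * t)) =
        fun t => (∑ j ∈ S, c j * exp (-l j * (t + ε k))) -
          exp (-l k * ε k) * ∑ j ∈ S, c j * exp (-l j * t) := by
      funext t
      rw [Finset.mul_sum, ← Finset.sum_sub_distrib]
      refine Finset.sum_congr rfl fun j _ => ?_
      rw [mul_add, exp_add]
      ring
    rw [e1, Finset.prod_insert hk, Finset.sum_insert hk, mul_comm (1 + _),
      ENNReal.ofReal_mul (Finset.prod_nonneg fun m _ => by positivity), mul_assoc]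
    refine h1.trans ?_
    rw [e2]
    gcongr
    rwa [add_comm (ε k), ← add_assoc]

lemma exists_pos_le_prod_abs_of_summable_sub_one {x : ℕ → ℝ} (hx : Summable fun m => x m - 1) :
    ∃ δ > 0, ∀ R : Finset ℕ, (∀ m ∈ R, x m ≠ 0) → δ ≤ ∏ m ∈ R, |x m| := by
  have hlog : Summable fun m => log (x m) := by
    simpa using Real.summable_log_one_add_of_summable hx
  refine ⟨exp (-∑' m, |log (x m)|), exp_pos _, fun R hR => ?_⟩
  rw [Finset.prod_congr rfl fun m hm => (exp_log_eq_abs (hR m hm)).symm, ← exp_sum]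
  refine exp_le_exp.mpr ?_
  have h1 := hlog.abs.sum_le_tsum R fun m _ => abs_nonneg _
  have h2 := Finset.abs_sum_le_sum_abs (fun m => log (x m)) R
  linarith [neg_abs_le (∑ m ∈ R, log (x m))]

/-- The coefficients of an exponential sum are controlled by its `L²(0, T)` norm. -/
lemma exists_pos_mul_abs_coeff_le_eLpNorm {l ε : ℕ → ℝ} {T : ℝ} (hl : Function.Injective l)
    (hl0 : ∀ m, 0 ≤ l m) (hε : ∀ m, 0 < ε m) (hεs : Summable ε) (hεT : ∑' m, ε m < T)
    (hexp : Summable fun m => exp (-l m * ε m)) (n : ℕ) :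
    ∃ δ : ℝ, 0 < δ ∧ ∀ (S : Finset ℕ) (c : ℕ → ℝ), n ∈ S →
      ENNReal.ofReal (δ * |c n|) ≤ eLpNorm (fun t => ∑ j ∈ S, c j * exp (-l j * t)) 2
        (volume.restrict (Set.Ioc 0 T)) := by
  have hsub : Summable fun m => (exp (-l n * ε m) - exp (-l m * ε m)) - 1 := by
    have h1 : Summable fun m => 1 - exp (-l n * ε m) := by
      refine Summable.of_nonneg_of_le (fun m => ?_) (fun m => ?_) (hεs.mul_left (l n))
      · have : exp (-l n * ε m) ≤ 1 := exp_le_one_iff.mpr (by nlinarith [hl0 n, hε m])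
        linarith
      · linarith [add_one_le_exp (-l n * ε m)]
    refine (h1.neg.sub hexp).congr fun m => ?_
    ring
  obtain ⟨δ, hδ, hprod⟩ := exists_pos_le_prod_abs_of_summable_sub_one hsub
  set τ := T - ∑' m, ε m with hτ
  have hτ0 : 0 < τ := by linarith
  set M := exp (∑' m, exp (-l m * ε m))
  have hM : 0 < M := exp_pos _
  set κ := exp (-l n * τ) * √τ with hκ
  have hκ0 : 0 < κ := by positivity
  refine ⟨κ * δ / M, by positivity, fun S c hn => ?_⟩
  set R := S.erase n
  have key := eLpNorm_sum_prod_mul_exp_le (l := l) (fun m => (hε m).le) S R c τ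
  set D := ∏ m ∈ R, (exp (-l n * ε m) - exp (-l m * ε m))
  have hD : δ ≤ |D| := by
    rw [Finset.abs_prod]
    refine hprod R fun m hm h0 => ?_
    have h3 : -l n * ε m = -l m * ε m := exp_injective (sub_eq_zero.mp h0)
    have h4 := mul_right_cancel₀ (hε m).ne' h3
    exact Finset.ne_of_mem_erase hm (hl (neg_injective h4)).symm
  have hcollapse : (fun t => ∑ j ∈ S,
      c j * (∏ m ∈ R, (exp (-l j * ε m) - exp (-l m * ε m))) * exp (-l j * t)) =
      fun t => c n * D * exp (-l n * t) := by
    funext t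
    refine Finset.sum_eq_single_of_mem n hn fun j hj hjn => ?_
    rw [Finset.prod_eq_zero (Finset.mem_erase.mpr ⟨hjn, hj⟩) (sub_self _)]
    simp
  have hM_le : ∏ m ∈ R, (1 + exp (-l m * ε m)) ≤ M := by
    calc ∏ m ∈ R, (1 + exp (-l m * ε m)) ≤ ∏ m ∈ R, exp (exp (-l m * ε m)) :=
          Finset.prod_le_prod (fun m _ => by positivity) fun m _ => by
            linarith [add_one_le_exp (exp (-l m * ε m))]
      _ = exp (∑ m ∈ R, exp (-l m * ε m)) := (exp_sum _ _).symm
      _ ≤ M := exp_le_exp.mpr (hexp.sum_le_tsum R fun m _ => (exp_pos _).le)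
  have hlower : ENNReal.ofReal (κ * δ * |c n|) ≤
      eLpNorm (fun t => c n * D * exp (-l n * t)) 2 (volume.restrict (Set.Ioc 0 τ)) := by
    have h1 : eLpNorm (fun _ : ℝ => c n * D * exp (-l n * τ)) 2
        (volume.restrict (Set.Ioc 0 τ)) ≤
        eLpNorm (fun t => c n * D * exp (-l n * t)) 2 (volume.restrict (Set.Ioc 0 τ)) := by
      refine eLpNorm_mono_ae ?_
      filter_upwards [ae_restrict_mem measurableSet_Ioc] with t ht
      rw [norm_mul, norm_mul _ (exp _), Real.norm_of_nonneg (exp_pos _).le,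
        Real.norm_of_nonneg (exp_pos _).le]
      gcongr ?_ * ?_
      exact exp_le_exp.mpr (by nlinarith [hl0 n, ht.2])
    refine le_trans ?_ h1
    rw [eLpNorm_const' _ (by norm_num) (by norm_num), Measure.restrict_apply_univ,
      Real.volume_Ioc, sub_zero, ENNReal.ofReal_rpow_of_nonneg hτ0.le (by norm_num),
      ← ofReal_norm, ← ENNReal.ofReal_mul (norm_nonneg _)]
    refine ENNReal.ofReal_le_ofReal ?_
    rw [norm_mul, norm_mul, Real.norm_of_nonneg (exp_pos _).le, Real.norm_eq_abs, Real.norm_eq_abs]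
    have hs : τ ^ (1 / ENNReal.toReal 2) = √τ := by
      rw [sqrt_eq_rpow]; norm_num
    rw [hs, show |c n| * |D| * exp (-l n * τ) * √τ = κ * |D| * |c n| by rw [hκ]; ring]
    gcongr
  rw [hcollapse] at key
  have hupper : ENNReal.ofReal (κ * δ * |c n|) ≤ ENNReal.ofReal M *
      eLpNorm (fun t => ∑ j ∈ S, c j * exp (-l j * t)) 2 (volume.restrict (Set.Ioc 0 T)) := by
    refine (hlower.trans key).trans ?_
    refine mul_le_mul' (ENNReal.ofReal_le_ofReal hM_le) (eLpNorm_mono_measure _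
      (Measure.restrict_mono (Set.Ioc_subset_Ioc_right ?_) le_rfl))
    linarith [hεs.sum_le_tsum R fun m _ => (hε m).le]
  rw [show κ * δ / M * |c n| = κ * δ * |c n| / M by ring, ENNReal.ofReal_div_of_pos hM]
  exact ENNReal.div_le_of_le_mul' hupper

/-- A family `e` has a biorthogonal family as soon as, for every `n`, the linear combinations of `e`
in which `e n` has coefficient `1` stay away from `0`. -/
lemma exists_biorthogonal_of_coeff_le_norm {ι H : Type*} [DecidableEq ι] [NormedAddCommGroup H]
    [InnerProductSpace ℝ H] [CompleteSpace H] (e : ι → H)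
    (he : ∀ n, ∃ δ : ℝ, 0 < δ ∧ ∀ f : ι →₀ ℝ, f n = 1 →
      δ ≤ ‖Finsupp.linearCombination ℝ e f‖) :
    ∃ Θ : ι → H, ∀ m n, inner ℝ (e m) (Θ n) = if m = n then 1 else 0 := by
  have hn : ∀ n, ∃ v : H, ∀ m, inner ℝ (e m) v = if m = n then 1 else 0 := by
    intro n
    obtain ⟨δ, hδ, hle⟩ := he n
    set K := (Submodule.span ℝ (e '' {n}ᶜ)).topologicalClosure
    have hnK : e n ∉ K := by
      intro hmem
      obtain ⟨w, hw, hdist⟩ := Metric.mem_closure_iff.mp hmem δ hδ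
      obtain ⟨f, hf, rfl⟩ := (Finsupp.mem_span_image_iff_linearCombination ℝ).mp hw
      have hfn : f n = 0 := by
        by_contra h
        exact hf (Finsupp.mem_support_iff.mpr h) rfl
      have := hle (Finsupp.single n 1 - f) (by simp [hfn])
      rw [map_sub, Finsupp.linearCombination_single, one_smul, ← dist_eq_norm] at this
      linarith
    have : CompleteSpace K := (Submodule.isClosed_topologicalClosure _).completeSpace_coe
    set x := e n - K.starProjection (e n)
    have hx : x ∈ Kᗮ := K.sub_starProjection_mem_orthogonal _
    have hx0 : x ≠ 0 := fun h => hnK (by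
      rw [sub_eq_zero.mp h]
      exact K.starProjection_apply_mem _)
    have hxx : inner ℝ (e n) x = ‖x‖ ^ 2 := by
      rw [← real_inner_self_eq_norm_sq]
      conv_rhs => rw [show inner ℝ x x = inner ℝ (e n) x - inner ℝ (K.starProjection (e n)) x
        from inner_sub_left _ _ _]
      rw [(K.mem_orthogonal x).mp hx _ (K.starProjection_apply_mem _), sub_zero]
    refine ⟨(‖x‖ ^ 2)⁻¹ • x, fun m => ?_⟩
    rw [inner_smul_right]
    split_ifs with h
    · rw [h, hxx]
      exact inv_mul_cancel₀ (by positivity)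
    · rw [(K.mem_orthogonal x).mp hx (e m) (Submodule.le_topologicalClosure _
        (Submodule.subset_span ⟨m, h, rfl⟩)), mul_zero]
  choose Θ hΘ using hn
  exact ⟨Θ, fun m n => hΘ n m⟩

lemma memLp_exp_mul_restrict_Ioc (r T : ℝ) :
    MemLp (fun t => exp (r * t)) 2 (volume.restrict (Set.Ioc 0 T)) :=
  MemLp.of_bound (by fun_prop) (exp (|r| * T)) (by
    filter_upwards [ae_restrict_mem measurableSet_Ioc] with t ht
    rw [Real.norm_of_nonneg (exp_pos _).le]
    refine exp_le_exp.mpr ?_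
    calc r * t ≤ |r| * t := mul_le_mul_of_nonneg_right (le_abs_self r) ht.1.le
      _ ≤ |r| * T := mul_le_mul_of_nonneg_left ht.2 (abs_nonneg r))

/-- Existence of a biorthogonal family in `L²(0, T)` for real exponentials. -/
theorem exists_biorthogonal_exp {l ε : ℕ → ℝ} {T : ℝ} (hl : Function.Injective l)
    (hl0 : ∀ m, 0 ≤ l m) (hε : ∀ m, 0 < ε m) (hεs : Summable ε) (hεT : ∑' m, ε m < T)
    (hexp : Summable fun m => exp (-l m * ε m)) :
    ∃ Θ : ℕ → Lp ℝ 2 (volume.restrict (Set.Ioc (0 : ℝ) T)),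
      ∀ m n : ℕ, ∫ t in Set.Ioc 0 T, exp (-l m * t) * (Θ n : ℝ → ℝ) t
        = if m = n then 1 else 0 := by
  let e : ℕ → Lp ℝ 2 (volume.restrict (Set.Ioc (0 : ℝ) T)) :=
    fun m => (memLp_exp_mul_restrict_Ioc (-l m) T).toLp
  have hcoe (m : ℕ) : e m =ᵐ[volume.restrict (Set.Ioc 0 T)] fun t => exp (-l m * t) :=
    MemLp.coeFn_toLp _
  have hsum (S : Finset ℕ) (c : ℕ → ℝ) : (∑ j ∈ S, c j • e j : Lp ℝ 2 _)
      =ᵐ[volume.restrict (Set.Ioc 0 T)] fun t => ∑ j ∈ S, c j * exp (-l j * t) := by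
    induction S using Finset.induction_on with
    | empty => exact Lp.coeFn_zero ℝ 2 _
    | insert k S hk ih =>
      rw [Finset.sum_insert hk]
      filter_upwards [ih, Lp.coeFn_add (c k • e k) (∑ j ∈ S, c j • e j),
        Lp.coeFn_smul (c k) (e k), hcoe k] with t h1 h2 h3 h4
      rw [h2, Pi.add_apply, h1, h3, Pi.smul_apply, h4, Finset.sum_insert hk, smul_eq_mul]
  obtain ⟨Θ, hΘ⟩ := exists_biorthogonal_of_coeff_le_norm e fun n => by
    obtain ⟨δ, hδ, h⟩ := exists_pos_mul_abs_coeff_le_eLpNorm hl hl0 hε hεs hεT hexp n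
    refine ⟨δ, hδ, fun f hf => ?_⟩
    have := h f.support f (by simp [hf])
    rw [← eLpNorm_congr_ae (hsum f.support f), hf, abs_one, mul_one] at this
    rw [Finsupp.linearCombination_apply, Finsupp.sum, Lp.norm_def]
    exact (ENNReal.ofReal_le_iff_le_toReal (Lp.eLpNorm_ne_top _)).mp this
  refine ⟨Θ, fun m n => ?_⟩
  rw [← hΘ m n, L2.inner_def]
  refine integral_congr_ae ?_
  filter_upwards [hcoe m] with t ht
  rw [ht]
  exact mul_comm _ _

/-- Existence of a family in L²(0,T) biorthogonal to the exponential family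
{e^{−λ_m t}}, where λ_n = μ_n² are the eigenvalues. -/
theorem stmt_8 (T a b d : ℝ) (hT : 0 < T) (ha : 0 < a) (hd : 0 < d)
    (hb0 : 0 ≤ b) (hbd : b < d) (μ : ℕ → ℝ)
    (hμ : ∀ n : ℕ, μ n ∈ Set.Ioo (π * n) (π * n + π / 2) ∧ 0 < μ n ∧
      (a * (μ n) ^ 2 + b) * Real.sin (μ n) = d * (μ n) * Real.cos (μ n)) :
    ∃ Θ : ℕ → Lp ℝ 2 (volume.restrict (Set.Ioc (0:ℝ) T)),
      ∀ m n : ℕ, ∫ t in (0:ℝ)..T, Real.exp (-(μ m) ^ 2 * t) * (Θ n : ℝ → ℝ) t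
        = if m = n then 1 else 0 := by
  have hmono : StrictMono μ := strictMono_nat_of_lt_succ fun n => by
    have h1 := (hμ n).1.2
    have h2 := (hμ (n + 1)).1.1
    push_cast at h2
    nlinarith [pi_pos]
  have hμm (m : ℕ) : (m : ℝ) ≤ μ m := by
    have := (hμ m).1.1
    nlinarith [pi_gt_three, (Nat.cast_nonneg m : (0 : ℝ) ≤ m)]
  have hsummable : Summable fun m : ℕ => ((m : ℝ) + 1) ^ (-(3 / 2) : ℝ) := by
    have := (summable_nat_add_iff 1).mpr
      (Real.summable_nat_rpow.mpr (by norm_num : (-(3 / 2) : ℝ) < -1))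
    simpa using this
  set A := ∑' m : ℕ, ((m : ℝ) + 1) ^ (-(3 / 2) : ℝ)
  have hA : 0 ≤ A := tsum_nonneg fun m => by positivity
  set κ := T / (A + 1)
  have hκ : 0 < κ := by positivity
  obtain ⟨Θ, hΘ⟩ := exists_biorthogonal_exp (l := fun m => μ m ^ 2)
    (ε := fun m => κ * ((m : ℝ) + 1) ^ (-(3 / 2) : ℝ)) (T := T)
    (fun m n h => hmono.injective
      ((pow_left_inj₀ (hμ m).2.1.le (hμ n).2.1.le two_ne_zero).mp h))
    (fun m => sq_nonneg _) (fun m => by positivity) (hsummable.mul_left κ)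
    (by
      rw [tsum_mul_left, div_mul_eq_mul_div, div_lt_iff₀ (by positivity)]
      change T * A < _
      nlinarith)
    (by
      rw [← summable_nat_add_iff 1]
      have hsq : Summable fun m : ℕ => 24 * (4 / κ) ^ 4 * (1 / (((m + 2 : ℕ) : ℝ) ^ 2)) :=
        ((summable_nat_add_iff 2).mpr
          (Real.summable_one_div_nat_pow.mpr one_lt_two)).mul_left _
      refine Summable.of_nonneg_of_le (fun m => (exp_pos _).le) (fun m => ?_) hsq
      push_cast
      rw [show (m : ℝ) + 1 + 1 = m + 2 by ring]
      have h1 := hμm (m + 1)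
      push_cast at h1
      set y : ℝ := m + 2 with hy
      have hy0 : 0 < y := by positivity
      have hy2 : y ^ 2 / 4 ≤ μ (m + 1) ^ 2 := by
        nlinarith [(Nat.cast_nonneg m : (0 : ℝ) ≤ m)]
      have hpow : y ^ 2 * y ^ (-(3 / 2) : ℝ) = √y := by
        rw [← rpow_natCast, ← rpow_add hy0, sqrt_eq_rpow]
        norm_num
      set x := μ (m + 1) ^ 2 * (κ * y ^ (-(3 / 2) : ℝ)) with hx
      have hxy : κ / 4 * √y ≤ x := by
        rw [← hpow, hx]
        calc κ / 4 * (y ^ 2 * y ^ (-(3 / 2) : ℝ)) = y ^ 2 / 4 * (κ * y ^ (-(3 / 2) : ℝ)) := by ring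
          _ ≤ _ := by gcongr
      have hx4 : (κ / 4) ^ 4 * y ^ 2 ≤ x ^ 4 := by
        calc (κ / 4) ^ 4 * y ^ 2 = (κ / 4 * √y) ^ 4 := by
              rw [mul_pow, show √y ^ 4 = (√y ^ 2) ^ 2 by ring, sq_sqrt hy0.le]
          _ ≤ x ^ 4 := by gcongr
      have hexp : (κ / 4) ^ 4 * y ^ 2 / 24 ≤ exp x := by
        have h2 := Real.pow_div_factorial_le_exp x (by positivity) 4
        norm_num [Nat.factorial] at h2
        linarith
      rw [neg_mul, exp_neg]
      refine (inv_anti₀ (by positivity) hexp).trans_eq ?_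
      field_simp)
  refine ⟨Θ, fun m n => ?_⟩
  rw [intervalIntegral.integral_of_le hT.le, ← hΘ m n]
end

section
/- Let a, d > 0 and b > d. Then there exists μ₀ > 0 such that (b − a·μ₀²)·sinh μ₀ = d·μ₀·cosh μ₀. Consequently λ₀ = −μ₀² < 0 is an eigenvalue of the Sturm–Liouville problem, with eigenfunction y₀(x) = e^{μ₀x} − e^{−μ₀x}: this y₀ is nonzero and satisfies y₀'' + λ₀·y₀ = 0, y₀(0) = 0, and (a·λ₀ + b)·y₀(1) = d·y₀'(1). -/
open Real

/-- The hyperbolic characteristic equation has a positive root when `d < b`. -/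
theorem exists_pos_root_characteristic {a b d : ℝ} (ha : 0 < a) (hd : 0 < d) (hbd : d < b) :
    ∃ μ : ℝ, 0 < μ ∧ (b - a * μ ^ 2) * sinh μ = d * μ * cosh μ := by
  obtain ⟨l, hgl, hl⟩ : ∃ l : ℝ, 0 < b - a * l ^ 2 - d * cosh l ∧ 0 < l := by
    have hg : ContinuousAt (fun x : ℝ => b - a * x ^ 2 - d * cosh x) 0 := by fun_prop
    have hpos : ∀ᶠ x in nhds (0 : ℝ), 0 < b - a * x ^ 2 - d * cosh x :=
      hg.eventually (lt_mem_nhds (by simpa using hbd))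
    exact ((hpos.filter_mono nhdsWithin_le_nhds).and
      (self_mem_nhdsWithin : Set.Ioi (0 : ℝ) ∈ nhdsWithin 0 (Set.Ioi 0))).exists
  have hcosh : 0 < d * cosh l := mul_pos hd (cosh_pos l)
  have hb : 0 < b := hd.trans hbd
  have hr : 0 < √(b / a) := sqrt_pos.2 (div_pos hb ha)
  have hr2 : a * √(b / a) ^ 2 = b := by
    rw [sq_sqrt (div_pos hb ha).le, mul_div_cancel₀ _ ha.ne']
  have hlr : l ≤ √(b / a) := by
    apply le_sqrt_of_sq_le
    rw [le_div_iff₀ ha]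
    linarith
  have hFl : 0 ≤ (b - a * l ^ 2) * sinh l - d * l * cosh l := by
    have hsinh : l ≤ sinh l := self_le_sinh_iff.2 hl.le
    have h₁ := mul_le_mul_of_nonneg_left hsinh (by linarith : 0 ≤ b - a * l ^ 2)
    have h₂ := mul_pos hgl hl
    linarith
  have hFr : (b - a * √(b / a) ^ 2) * sinh √(b / a) - d * √(b / a) * cosh √(b / a) ≤ 0 := by
    rw [hr2]
    have := mul_pos (mul_pos hd hr) (cosh_pos √(b / a))
    linarith
  have hF : ContinuousOn (fun x : ℝ => (b - a * x ^ 2) * sinh x - d * x * cosh x)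
      (Set.Icc l √(b / a)) := by fun_prop
  obtain ⟨μ, hμ, hroot⟩ := intermediate_value_Icc' hlr hF ⟨hFr, hFl⟩
  exact ⟨μ, hl.trans_le hμ.1, sub_eq_zero.1 hroot⟩

theorem hasDerivAt_exp_const_mul (c x : ℝ) :
    HasDerivAt (fun x : ℝ => exp (c * x)) (c * exp (c * x)) x := by
  simpa [mul_comm] using ((hasDerivAt_id x).const_mul c).exp

/-- In the case b > d there is a negative eigenvalue λ₀ = −μ₀²: the hyperbolic
characteristic equation (b − aμ₀²) sinh μ₀ = dμ₀ cosh μ₀ has a positive root,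
and y₀(x) = e^{μ₀x} − e^{−μ₀x} is a corresponding eigenfunction. -/
theorem stmt_10 (a b d : ℝ) (ha : 0 < a) (hd : 0 < d) (hbd : d < b) :
    ∃ μ₀ : ℝ, 0 < μ₀ ∧
      (b - a * μ₀ ^ 2) * Real.sinh μ₀ = d * μ₀ * Real.cosh μ₀ ∧
      (fun x : ℝ => Real.exp (μ₀ * x) - Real.exp (-μ₀ * x)) ≠ 0 ∧
      (∀ x : ℝ,
        deriv (deriv (fun x : ℝ => Real.exp (μ₀ * x) - Real.exp (-μ₀ * x))) x
          + (-μ₀ ^ 2) * (Real.exp (μ₀ * x) - Real.exp (-μ₀ * x)) = 0) ∧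
      (Real.exp (μ₀ * 0) - Real.exp (-μ₀ * 0) = 0) ∧
      (a * (-μ₀ ^ 2) + b) * (Real.exp (μ₀ * 1) - Real.exp (-μ₀ * 1))
        = d * deriv (fun x : ℝ => Real.exp (μ₀ * x) - Real.exp (-μ₀ * x)) 1 := by
  obtain ⟨μ, hμ, hroot⟩ := exists_pos_root_characteristic ha hd hbd
  have hderiv : deriv (fun x : ℝ => Real.exp (μ * x) - Real.exp (-μ * x)) =
      fun x => μ * Real.exp (μ * x) - -μ * Real.exp (-μ * x) :=
    funext fun x => ((hasDerivAt_exp_const_mul μ x).sub (hasDerivAt_exp_const_mul (-μ) x)).deriv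
  refine ⟨μ, hμ, hroot, fun h => ?_, fun x => ?_, by simp, ?_⟩
  · have h1 : Real.exp (-μ * 1) < Real.exp (μ * 1) := Real.exp_lt_exp.2 (by linarith)
    have h2 : Real.exp (μ * 1) - Real.exp (-μ * 1) = 0 := congrFun h 1
    linarith
  · have h2 := (((hasDerivAt_exp_const_mul μ x).const_mul μ).sub
      ((hasDerivAt_exp_const_mul (-μ) x).const_mul (-μ))).deriv
    rw [hderiv]
    refine (congrArg (· + _) h2).trans ?_
    ring
  · rw [hderiv]
    rw [Real.sinh_eq, Real.cosh_eq] at hroot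
    simp only [mul_one]
    linear_combination 2 * hroot
end

section
/- Let a, d > 0 and b < d. If λ ∈ ℝ and there exists a nonzero twice continuously differentiable function y : [0,1] → ℝ with y''(x) + λ·y(x) = 0 for all x ∈ [0,1], y(0) = 0, and (a·λ + b)·y(1) = d·y'(1), then λ > 0. -/
open Real

/-- If `y'' + lam y = 0` on `[0, 1]` with `lam ≤ 0` and `y 0 = 0`, then
`x ↦ y x * y' x - 2 c y x + c² x` is nonnegative on `[0, 1]`, since it vanishes at `0` and its
derivative is `(y' - c)² - lam y²`. -/
lemma energy_nonneg {lam : ℝ} (hlam : lam ≤ 0) {y : ℝ → ℝ} (hy : ContDiff ℝ 2 y)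
    (hode : ∀ x ∈ Set.Icc (0:ℝ) 1, deriv (deriv y) x + lam * y x = 0)
    (h0 : y 0 = 0) (c : ℝ) {x : ℝ} (hx : x ∈ Set.Icc (0:ℝ) 1) :
    0 ≤ y x * deriv y x - 2 * c * y x + c ^ 2 * x := by
  have hy1 : Differentiable ℝ y := hy.differentiable (by norm_num)
  have hy2 : Differentiable ℝ (deriv y) :=
    (hy.deriv' (n := 1)).differentiable (by norm_num)
  have hder : ∀ t, HasDerivAt (fun s => y s * deriv y s - 2 * c * y s + c ^ 2 * s)
      (deriv y t * deriv y t + y t * deriv (deriv y) t - 2 * c * deriv y t + c ^ 2 * 1) t :=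
    fun t => (((hy1 t).hasDerivAt.mul (hy2 t).hasDerivAt).sub
      ((hy1 t).hasDerivAt.const_mul (2 * c))).add ((hasDerivAt_id t).const_mul (c ^ 2))
  have hmono : MonotoneOn (fun s => y s * deriv y s - 2 * c * y s + c ^ 2 * s)
      (Set.Icc (0:ℝ) 1) := by
    refine monotoneOn_of_deriv_nonneg (convex_Icc 0 1)
      (fun t _ => (hder t).continuousAt.continuousWithinAt)
      (fun t _ => (hder t).differentiableAt.differentiableWithinAt) fun t ht => ?_
    rw [(hder t).deriv]
    have hode_t : deriv (deriv y) t = -lam * y t := by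
      linarith [hode t (interior_subset ht)]
    rw [hode_t]
    nlinarith [sq_nonneg (deriv y t - c), mul_nonneg (neg_nonneg.2 hlam) (sq_nonneg (y t))]
  simpa [h0] using hmono (Set.left_mem_Icc.2 zero_le_one) hx hx.1

/-- In the regime b < d (with a, d > 0), all eigenvalues of the
Sturm–Liouville problem are strictly positive. -/
theorem stmt_12 (a b d : ℝ) (ha : 0 < a) (hd : 0 < d) (hbd : b < d)
    (lam : ℝ) (y : ℝ → ℝ) (hy : ContDiff ℝ 2 y)
    (hne : ∃ x ∈ Set.Icc (0:ℝ) 1, y x ≠ 0)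
    (hode : ∀ x ∈ Set.Icc (0:ℝ) 1, deriv (deriv y) x + lam * y x = 0)
    (h0 : y 0 = 0)
    (hbc : (a * lam + b) * y 1 = d * deriv y 1) :
    0 < lam := by
  by_contra! hlam
  obtain ⟨x, hx, hyx⟩ := hne
  have hy1 : Differentiable ℝ y := hy.differentiable (by norm_num)
  have hder : ∀ t, HasDerivAt (fun s => y s ^ 2) (2 * y t * deriv y t) t := fun t => by
    simpa using (hy1 t).hasDerivAt.fun_pow 2
  have hmono : MonotoneOn (fun s => y s ^ 2) (Set.Icc (0:ℝ) 1) := by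
    refine monotoneOn_of_deriv_nonneg (convex_Icc 0 1)
      (fun t _ => (hder t).continuousAt.continuousWithinAt)
      (fun t _ => (hder t).differentiableAt.differentiableWithinAt) fun t ht => ?_
    rw [(hder t).deriv]
    linarith [energy_nonneg hlam hy hode h0 0 (interior_subset ht)]
  have h1 : (1:ℝ) ∈ Set.Icc (0:ℝ) 1 := Set.right_mem_Icc.2 zero_le_one
  have hle : y x ^ 2 ≤ y 1 ^ 2 := hmono hx h1 hx.2
  have hpos : 0 < y 1 ^ 2 := (pow_pos (abs_pos.2 hyx) 2).trans_le (by rwa [sq_abs])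
  have hflux : y 1 ^ 2 ≤ y 1 * deriv y 1 := by
    linarith [energy_nonneg hlam hy hode h0 (y 1) h1]
  have hbc' : d * (y 1 * deriv y 1) = (a * lam + b) * y 1 ^ 2 := by
    linear_combination -y 1 * hbc
  have hcoef : a * lam + b < d := by
    linarith [mul_nonpos_of_nonneg_of_nonpos ha.le hlam]
  linarith [mul_le_mul_of_nonneg_left hflux hd.le, mul_lt_mul_of_pos_right hcoef hpos]
end

section
/- Let a, d > 0 and b ∈ ℝ. There exists a real number μ such that for every continuously differentiable function v : [0,1] → ℝ with v(0) = 0, the inequality ∫₀¹ v'(x)² dx − (b/d)·v(1)² + μ·(∫₀¹ v(x)² dx + (a/d)·v(1)²) ≥ (1/2)·(∫₀¹ v'(x)² dx + ∫₀¹ v(x)² dx + (a/d)·v(1)²) holds. -/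
open Real

/-- Coercivity of the shifted bilinear form 𝔞 + μ associated with the Wentzell
operator, on the form domain {v ∈ H¹(0,1) : v(0) = 0}. -/
theorem stmt_13 (a b d : ℝ) (ha : 0 < a) (hd : 0 < d) :
    ∃ μ : ℝ, ∀ v : ℝ → ℝ, ContDiff ℝ 1 v → v 0 = 0 →
      (∫ x in (0:ℝ)..1, (deriv v x) ^ 2) - (b / d) * (v 1) ^ 2
        + μ * ((∫ x in (0:ℝ)..1, (v x) ^ 2) + (a / d) * (v 1) ^ 2)
      ≥ (1 / 2) * ((∫ x in (0:ℝ)..1, (deriv v x) ^ 2)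
          + (∫ x in (0:ℝ)..1, (v x) ^ 2) + (a / d) * (v 1) ^ 2) := by
  refine ⟨1 / 2 + |b| / a, fun v _ _ => ?_⟩
  have hderiv : 0 ≤ ∫ x in (0:ℝ)..1, (deriv v x) ^ 2 :=
    intervalIntegral.integral_nonneg zero_le_one fun _ _ => sq_nonneg _
  have hv : 0 ≤ |b| / a * ∫ x in (0:ℝ)..1, (v x) ^ 2 :=
    mul_nonneg (by positivity)
      (intervalIntegral.integral_nonneg zero_le_one fun _ _ => sq_nonneg _)
  have hboundary : b / d * (v 1) ^ 2 ≤ |b| / a * (a / d * (v 1) ^ 2) := by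
    rw [← mul_assoc, div_mul_div_cancel₀ ha.ne']
    gcongr
    exact le_abs_self b
  linarith
end

section
/- Let T > 0, let a, d > 0 and b ∈ ℝ, let μ > 0 satisfy (a·μ² + b)·sin μ = d·μ·cos μ, and set λ = μ². Let f : [0,T] → ℝ be continuous and let u : [0,1] × [0,T] → ℝ be a twice continuously differentiable function satisfying u_t(x,t) = u_xx(x,t) for (x,t) ∈ (0,1) × (0,T), u(0,t) = f(t), and a·u_xx(1,t) + d·u_x(1,t) − b·u(1,t) = 0 for t ∈ (0,T). Then ∫₀¹ u(x,T)·sin(μx) dx + (a/d)·u(1,T)·sin μ = e^{−λT}·(∫₀¹ u(x,0)·sin(μx) dx + (a/d)·u(1,0)·sin μ) + μ·∫₀ᵀ e^{−λ(T−t)}·f(t) dt. -/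
open Real MeasureTheory

/-- The partial derivative in the first variable of a `C^(n+1)` function of two variables
exists and is `C^n`. -/
lemma exists_contDiff_hasDerivAt_fst {u : ℝ → ℝ → ℝ} {m n : WithTop ℕ∞}
    (hu : ContDiff ℝ n (Function.uncurry u)) (hmn : m + 1 ≤ n) :
    ∃ v : ℝ → ℝ → ℝ, ContDiff ℝ m (Function.uncurry v) ∧
      ∀ x t, HasDerivAt (fun y => u y t) (v x t) x := by
  have hn : n ≠ 0 := by
    rintro rfl
    simp at hmn
  refine ⟨fun x t => fderiv ℝ (Function.uncurry u) (x, t) (1, 0),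
    (hu.fderiv_right hmn).clm_apply contDiff_const, fun x t => ?_⟩
  have h := ((hu.differentiable hn) (x, t)).hasFDerivAt
  exact h.comp_hasDerivAt x ((hasDerivAt_id x).prodMk (hasDerivAt_const x t))

/-- The partial derivative in the second variable of a `C^(n+1)` function of two variables
exists and is `C^n`. -/
lemma exists_contDiff_hasDerivAt_snd {u : ℝ → ℝ → ℝ} {m n : WithTop ℕ∞}
    (hu : ContDiff ℝ n (Function.uncurry u)) (hmn : m + 1 ≤ n) :
    ∃ v : ℝ → ℝ → ℝ, ContDiff ℝ m (Function.uncurry v) ∧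
      ∀ x t, HasDerivAt (fun s => u x s) (v x t) t := by
  have hn : n ≠ 0 := by
    rintro rfl
    simp at hmn
  refine ⟨fun x t => fderiv ℝ (Function.uncurry u) (x, t) (0, 1),
    (hu.fderiv_right hmn).clm_apply contDiff_const, fun x t => ?_⟩
  have h := ((hu.differentiable hn) (x, t)).hasFDerivAt
  exact h.comp_hasDerivAt t ((hasDerivAt_const t x).prodMk (hasDerivAt_id t))

/-- Differentiation under the integral sign over a compact interval, for an integrand that is
continuous together with its derivative in the parameter. -/
lemma hasDerivAt_intervalIntegral_of_continuous {F F' : ℝ → ℝ → ℝ} (p q t : ℝ)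
    (hF : Continuous (Function.uncurry F)) (hF' : Continuous (Function.uncurry F'))
    (hderiv : ∀ x s, HasDerivAt (fun r => F x r) (F' x s) s) :
    HasDerivAt (fun s => ∫ x in p..q, F x s) (∫ x in p..q, F' x t) t := by
  obtain ⟨C, hC⟩ := ((isCompact_uIcc (a := p) (b := q)).prod
    (isCompact_closedBall t 1)).exists_bound_of_continuousOn hF'.continuousOn
  have hFs : ∀ s, Continuous fun x => F x s := fun s => by fun_prop
  have hFs' : ∀ s, Continuous fun x => F' x s := fun s => by fun_prop
  refine (intervalIntegral.hasDerivAt_integral_of_dominated_loc_of_deriv_le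
    (F := fun s x => F x s) (F' := fun s x => F' x s) (bound := fun _ => C)
    (Metric.closedBall_mem_nhds t one_pos)
    (Filter.Eventually.of_forall fun s => (hFs s).aestronglyMeasurable)
    ((hFs t).intervalIntegrable _ _) (hFs' t).aestronglyMeasurable
    (Filter.Eventually.of_forall fun x hx s hs => ?_) intervalIntegrable_const
    (Filter.Eventually.of_forall fun x _ s _ => hderiv x s)).2
  exact hC (x, s) ⟨Set.uIoc_subset_uIcc hx, hs⟩

/-- Green's identity on `[0, 1]` against `sin (μ x)`. -/
lemma integral_second_deriv_mul_sin (μ : ℝ) {w w' w'' : ℝ → ℝ}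
    (hw : ∀ x, HasDerivAt w (w' x) x) (hw' : ∀ x, HasDerivAt w' (w'' x) x)
    (hw'' : Continuous w'') :
    ∫ x in (0:ℝ)..1, w'' x * Real.sin (μ * x) =
      w' 1 * Real.sin μ - μ * w 1 * Real.cos μ + μ * w 0
        - μ ^ 2 * ∫ x in (0:ℝ)..1, w x * Real.sin (μ * x) := by
  have hcw : Continuous w := continuous_iff_continuousAt.2 fun x => (hw x).continuousAt
  have hsin : ∀ x, HasDerivAt (fun x => Real.sin (μ * x)) (μ * Real.cos (μ * x)) x := fun x => by
    refine ((hasDerivAt_id' x).const_mul μ).sin.congr_deriv ?_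
    ring
  have hcos : ∀ x, HasDerivAt (fun x => Real.cos (μ * x)) (-(μ * Real.sin (μ * x))) x :=
    fun x => by
      refine ((hasDerivAt_id' x).const_mul μ).cos.congr_deriv ?_
      ring
  have hder : ∀ x, HasDerivAt
      (fun x => w' x * Real.sin (μ * x) - μ * (w x * Real.cos (μ * x)))
      (w'' x * Real.sin (μ * x) + μ ^ 2 * (w x * Real.sin (μ * x))) x := fun x => by
    refine (((hw' x).mul (hsin x)).sub (((hw x).mul (hcos x)).const_mul μ)).congr_deriv ?_
    ring
  have hint := intervalIntegral.integral_eq_sub_of_hasDerivAt (a := 0) (b := 1)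
    (fun x _ => hder x) (Continuous.intervalIntegrable (by fun_prop) _ _)
  rw [intervalIntegral.integral_add (Continuous.intervalIntegrable (by fun_prop) _ _)
    (Continuous.intervalIntegrable (by fun_prop) _ _),
    intervalIntegral.integral_const_mul] at hint
  simp only [mul_one, mul_zero, Real.sin_zero, Real.cos_zero] at hint
  linarith

/-- Moment identity: pairing a solution of the controlled heat equation with
the backward adjoint eigen-solution e^{−λ(T−t)} sin(μx). -/
theorem stmt_17 (T a b d : ℝ) (hT : 0 < T) (ha : 0 < a) (hd : 0 < d)
    (μ : ℝ) (hμ : 0 < μ)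
    (hchar : (a * μ ^ 2 + b) * Real.sin μ = d * μ * Real.cos μ)
    (f : ℝ → ℝ) (hf : ContinuousOn f (Set.Icc 0 T))
    (u : ℝ → ℝ → ℝ) (hu : ContDiff ℝ 2 (Function.uncurry u))
    (heat : ∀ x ∈ Set.Ioo (0:ℝ) 1, ∀ t ∈ Set.Ioo (0:ℝ) T,
      deriv (fun s => u x s) t = deriv (deriv (fun y => u y t)) x)
    (hDir : ∀ t ∈ Set.Ioo (0:ℝ) T, u 0 t = f t)
    (hWent : ∀ t ∈ Set.Ioo (0:ℝ) T,
      a * deriv (deriv (fun y => u y t)) 1 + d * deriv (fun y => u y t) 1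
        - b * u 1 t = 0) :
    (∫ x in (0:ℝ)..1, u x T * Real.sin (μ * x))
        + (a / d) * (u 1 T * Real.sin μ)
      = Real.exp (-(μ ^ 2) * T) *
          ((∫ x in (0:ℝ)..1, u x 0 * Real.sin (μ * x))
            + (a / d) * (u 1 0 * Real.sin μ))
        + μ * ∫ t in (0:ℝ)..T, Real.exp (-(μ ^ 2) * (T - t)) * f t := by
  obtain ⟨ux, hux, hdx⟩ := exists_contDiff_hasDerivAt_fst (m := 1) hu (by norm_num)
  obtain ⟨uxx, huxx, hdxx⟩ := exists_contDiff_hasDerivAt_fst (m := 0) hux (by norm_num)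
  obtain ⟨ut, hut, hdt⟩ := exists_contDiff_hasDerivAt_snd (m := 1) hu (by norm_num)
  have hcu := hu.continuous
  have hcxx := huxx.continuous
  have hct := hut.continuous
  have hdx_eq : ∀ t, deriv (fun y => u y t) = fun y => ux y t :=
    fun t => funext fun y => (hdx y t).deriv
  have hdxx_eq : ∀ x t, deriv (deriv fun y => u y t) x = uxx x t := fun x t => by
    rw [hdx_eq, (hdxx x t).deriv]
  have hheat : ∀ t ∈ Set.Ioo (0:ℝ) T, ∀ x ∈ Set.Icc (0:ℝ) 1, ut x t = uxx x t := by
    intro t ht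
    have h : Set.EqOn (fun x => ut x t) (fun x => uxx x t) (Set.Ioo 0 1) := fun x hx => by
      have := heat x hx t ht
      rwa [(hdt x t).deriv, hdxx_eq] at this
    have := h.closure (by fun_prop) (by fun_prop)
    rwa [closure_Ioo zero_ne_one] at this
  set E : ℝ → ℝ := fun t =>
    (∫ x in (0:ℝ)..1, u x t * Real.sin (μ * x)) + (a / d) * (u 1 t * Real.sin μ) with hE
  have hE' : ∀ t, HasDerivAt E
      ((∫ x in (0:ℝ)..1, ut x t * Real.sin (μ * x)) + (a / d) * (ut 1 t * Real.sin μ)) t :=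
    fun t => (hasDerivAt_intervalIntegral_of_continuous (F := fun x t => u x t * Real.sin (μ * x))
      (F' := fun x t => ut x t * Real.sin (μ * x)) 0 1 t (by fun_prop) (by fun_prop)
      fun x s => (hdt x s).mul_const _).add (((hdt 1 t).mul_const _).const_mul _)
  have hode : ∀ t ∈ Set.Ioo (0:ℝ) T, HasDerivAt E (μ * f t - μ ^ 2 * E t) t := by
    intro t ht
    refine (hE' t).congr_deriv ?_
    have hint : ∫ x in (0:ℝ)..1, ut x t * Real.sin (μ * x) =
        ∫ x in (0:ℝ)..1, uxx x t * Real.sin (μ * x) :=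
      intervalIntegral.integral_congr fun x hx => by
        rw [Set.uIcc_of_le zero_le_one] at hx
        simp only [hheat t ht x hx]
    have hW := hWent t ht
    rw [hdxx_eq, hdx_eq] at hW
    rw [hint, integral_second_deriv_mul_sin μ (fun x => hdx x t) (fun x => hdxx x t)
      (by fun_prop), hheat t ht 1 (by simp), hDir t ht]
    simp only [hE]
    field_simp
    linear_combination u 1 t * hchar + Real.sin μ * hW
  have hexp : ∀ t, HasDerivAt (fun t => Real.exp (-(μ ^ 2) * (T - t)))
      (μ ^ 2 * Real.exp (-(μ ^ 2) * (T - t))) t := fun t => by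
    refine (((hasDerivAt_id' t).const_sub T).const_mul (-(μ ^ 2))).exp.congr_deriv ?_
    ring
  have hcE : Continuous E := continuous_iff_continuousAt.2 fun t => (hE' t).continuousAt
  have hFTC := intervalIntegral.integral_eq_sub_of_hasDerivAt_of_le hT.le
    (f := fun t => Real.exp (-(μ ^ 2) * (T - t)) * E t)
    (f' := fun t => μ * (Real.exp (-(μ ^ 2) * (T - t)) * f t)) (by fun_prop)
    (fun t ht => by
      refine ((hexp t).mul (hode t ht)).congr_deriv ?_
      ring)
    (ContinuousOn.intervalIntegrable_of_Icc hT.le (by fun_prop))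
  rw [intervalIntegral.integral_const_mul] at hFTC
  simp only [sub_self, sub_zero, mul_zero, Real.exp_zero, one_mul] at hFTC
  change E T = _ * E 0 + _
  linarith
end
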